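/- Let R be a commutative ℂ-algebra that is an integral domain, and let A and B be nonzero finite-dimensional ℂ-linear subspaces of R. Then the ℂ-linear span of the set of products {a·b : a ∈ A, b ∈ B} has dimension at least dim A + dim B − 1. -/

import Mathlib

namespace ValuationSubring

variable {K : Type*} [Field K]

/-- The intersection of a chain of valuation subrings is a valuation subring. -/
theorem exists_mem_iff_forall_mem_of_isChain {c : Set (ValuationSubring K)}
    (hc : IsChain (· ≤ ·) c) :
    ∃ V : ValuationSubring K, ∀ x, x ∈ V ↔ ∀ W ∈ c, x ∈ W := by
  refine ⟨.ofSubring (⨅ W ∈ c, W.toSubring) fun x ↦ ?_, fun x ↦ by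
    simp [mem_ofSubring, Subring.mem_iInf]⟩
  simp only [Subring.mem_iInf, mem_toSubring]
  by_contra! h
  obtain ⟨⟨V, hV, hxV⟩, W, hW, hxW⟩ := h
  rcases hc.total hV hW with h | h
  · exact hxV ((V.mem_or_inv_mem x).resolve_right fun hx ↦ hxW (h hx))
  · exact hxW ((W.mem_or_inv_mem x).resolve_left fun hx ↦ hxV (h hx))

/-- The composite of a valuation subring `V` of `K` with a valuation subring of its residue
field. -/
theorem exists_mem_iff_residue_mem (V : ValuationSubring K)
    (W : ValuationSubring (IsLocalRing.ResidueField V)) :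
    ∃ U : ValuationSubring K, ∀ x, x ∈ U ↔ ∃ h : x ∈ V, IsLocalRing.residue V ⟨x, h⟩ ∈ W := by
  have hmem (x : K) : x ∈ (W.toSubring.comap (IsLocalRing.residue V)).map V.subtype ↔
      ∃ h : x ∈ V, IsLocalRing.residue V ⟨x, h⟩ ∈ W := by
    simp [Subring.mem_map, and_comm]
  have of_mem (x : K) (hx : x ∈ V) : (∃ h : x ∈ V, IsLocalRing.residue V ⟨x, h⟩ ∈ W) ∨
      ∃ h : x⁻¹ ∈ V, IsLocalRing.residue V ⟨x⁻¹, h⟩ ∈ W := by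
    by_cases hu : IsUnit (⟨x, hx⟩ : V)
    · obtain ⟨y, hy⟩ := hu.exists_right_inv
      have hx0 : x * y = 1 := congrArg Subtype.val hy
      have hinv : x⁻¹ = y := inv_eq_of_mul_eq_one_right hx0
      refine (W.mem_or_inv_mem (IsLocalRing.residue V ⟨x, hx⟩)).imp (⟨hx, ·⟩) fun h ↦ ?_
      have hy' : (⟨x⁻¹, hinv ▸ y.2⟩ : V) = y := Subtype.ext hinv
      refine ⟨hinv ▸ y.2, ?_⟩
      rw [hy']
      rwa [inv_eq_of_mul_eq_one_right (b := IsLocalRing.residue V y)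
        (by rw [← map_mul, hy, map_one])] at h
    · refine .inl ⟨hx, ?_⟩
      rw [(IsLocalRing.residue_eq_zero_iff _).2 ((IsLocalRing.mem_maximalIdeal _).2 hu)]
      exact W.zero_mem
  refine ⟨.ofSubring _ fun x ↦ ?_, fun x ↦ (mem_ofSubring _ _ _).trans (hmem x)⟩
  rw [hmem, hmem]
  rcases V.mem_or_inv_mem x with h | h
  · exact of_mem x h
  · simpa [or_comm] using of_mem _ h

end ValuationSubring

section Field

variable {k K : Type*} [Field k] [IsAlgClosed k] [Field K]

/-- A field extension of an algebraically closed field `k` containing `t ∉ k` has a valuation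
subring over `k` that does not contain `t`. -/
theorem exists_valuationSubring_notMem [Algebra k K] {t : K} (ht : t ∉ (algebraMap k K).range) :
    ∃ V : ValuationSubring K, (∀ c, algebraMap k K c ∈ V) ∧ t ∉ V := by
  have : IsIntegrallyClosedIn (algebraMap k K).range K := by
    refine isIntegrallyClosedIn_iff.2 ⟨Subtype.val_injective, fun {x} hx ↦ ?_⟩
    have hx' : IsIntegral k x := by
      obtain ⟨p, hp, h⟩ := hx
      obtain ⟨q, hq, -, hqm⟩ := Polynomial.lifts_and_natDegree_eq_and_monic
        ((Polynomial.mem_lifts p).2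
          (Polynomial.map_surjective _ (algebraMap k K).rangeRestrict_surjective p)) hp
      refine ⟨q, hqm, ?_⟩
      rwa [← hq, Polynomial.eval₂_map] at h
    obtain ⟨c, hc⟩ := minpoly.mem_range_of_degree_eq_one k x
      (IsAlgClosed.degree_eq_one_of_irreducible k (minpoly.irreducible hx'))
    exact ⟨⟨x, c, hc⟩, rfl⟩
  obtain ⟨V, hV, h⟩ := Subring.exists_le_valuationSubring_of_isIntegrallyClosedIn ht
  exact ⟨V, fun c ↦ hV ⟨c, rfl⟩, h⟩

/-- A field extension of an algebraically closed field `k` carries a valuation subring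
containing `k` whose residue field is `k`. -/
theorem exists_valuationSubring_residue [Algebra k K] :
    ∃ V : ValuationSubring K, (∀ c : k, algebraMap k K c ∈ V) ∧
      ∀ x ∈ V, ∃ c : k, V.valuation (x - algebraMap k K c) < 1 := by
  obtain ⟨V, hV, hmin⟩ : ∃ V, Minimal
      (· ∈ {V : ValuationSubring K | ∀ c : k, algebraMap k K c ∈ V}) V := by
    refine @zorn_le₀ (ValuationSubring K)ᵒᵈ _ _ fun c hcS hc ↦ ?_
    obtain ⟨V, hV⟩ := ValuationSubring.exists_mem_iff_forall_mem_of_isChain hc.symm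
    exact ⟨V, fun a ↦ (hV _).2 fun W hW ↦ hcS hW a, fun W hW x hx ↦ (hV x).1 hx W hW⟩
  refine ⟨V, hV, fun x hx ↦ ?_⟩
  let φ : k →+* V := (algebraMap k K).codRestrict V.toSubring hV
  let _ : Algebra k (IsLocalRing.ResidueField V) := ((IsLocalRing.residue V).comp φ).toAlgebra
  by_contra! h
  obtain ⟨W, hW, hxW⟩ := exists_valuationSubring_notMem (k := k)
      (t := IsLocalRing.residue V ⟨x, hx⟩) <| by
    rintro ⟨c, hc⟩
    refine (h c).not_gt ?_
    have : IsLocalRing.residue V (⟨x, hx⟩ - φ c) = 0 := by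
      rw [map_sub, ← hc]; exact sub_self _
    rw [IsLocalRing.residue_eq_zero_iff, V.valuation_lt_one_iff] at this
    exact this
  obtain ⟨U, hU⟩ := V.exists_mem_iff_residue_mem W
  have hUV : U ≤ V := fun y hy ↦ ((hU y).1 hy).1
  obtain ⟨_, hx'⟩ := (hU x).1 (hmin (fun c ↦ (hU _).2 ⟨hV c, hW c⟩) hUV hx)
  exact hxW hx'

/-- A field extension of an algebraically closed field `k` carries a valuation, trivial on `k`, all
of whose leaves are one-dimensional. -/
theorem exists_valuation_sub_smul_lt (k K : Type*) [Field k] [IsAlgClosed k] [Field K]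
    [Algebra k K] :
    ∃ V : ValuationSubring K, (∀ c : k, V.valuation (algebraMap k K c) ≤ 1) ∧
      ∀ x y, y ≠ 0 → V.valuation x = V.valuation y →
        ∃ c : k, V.valuation (x - c • y) < V.valuation y := by
  obtain ⟨V, hV, h⟩ := exists_valuationSubring_residue (k := k) (K := K)
  refine ⟨V, fun c ↦ (V.valuation_le_one_iff _).2 (hV c), fun x y hy hxy ↦ ?_⟩
  have hv : 0 < V.valuation y := zero_lt_iff.2 (by simpa using hy)
  obtain ⟨c, hc⟩ := h (x / y) ((V.valuation_le_one_iff _).1 (by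
    rw [map_div₀, hxy, div_self hv.ne']))
  refine ⟨c, ?_⟩
  have : x - c • y = (x / y - algebraMap k K c) * y := by
    rw [sub_mul, div_mul_cancel₀ _ hy, Algebra.smul_def]
  rw [this, map_mul]
  exact mul_lt_of_lt_one_left hv hc

section Leaves

variable {k K Γ : Type*} [Field k] [Field K] [Algebra k K] [LinearOrderedCommGroupWithZero Γ]
  {v : Valuation K Γ}

/-- The vectors of `E` of valuation less than `m`. -/
def Submodule.valuationLT (hk : ∀ c : k, v (algebraMap k K c) ≤ 1) (E : Submodule k K) (m : Γˣ) :
    Submodule k K where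
  carrier := {x | x ∈ E ∧ v x < m}
  add_mem' hx hy := ⟨E.add_mem hx.1 hy.1, v.map_add_lt hx.2 hy.2⟩
  zero_mem' := ⟨E.zero_mem, by simp⟩
  smul_mem' c x hx := ⟨E.smul_mem c hx.1, by
    rw [Algebra.smul_def, map_mul]
    exact (mul_le_of_le_one_left' (hk c)).trans_lt hx.2⟩

theorem card_le_finrank_of_forall_exists_valuation_eq (hk : ∀ c : k, v (algebraMap k K c) ≤ 1)
    (T : Finset Γˣ) (E : Submodule k K) [FiniteDimensional k E]
    (hT : ∀ m ∈ T, ∃ x ∈ E, v x = m) : T.card ≤ Module.finrank k E := by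
  induction T using Finset.induction_on_max generalizing E with
  | empty => simp
  | insert m T hm ih =>
    obtain ⟨f, hf, hfm⟩ := hT m (Finset.mem_insert_self _ _)
    have hlt : E.valuationLT hk m < E :=
      lt_of_le_of_ne (fun x hx ↦ hx.1) fun h ↦ (h.ge hf).2.ne hfm
    have := Submodule.finiteDimensional_of_le hlt.le
    rw [Finset.card_insert_of_notMem fun h ↦ (hm m h).false]
    refine (Nat.succ_le_succ (ih (E.valuationLT hk m) fun a ha ↦ ?_)).trans
      (Submodule.finrank_lt_finrank_of_lt hlt)
    obtain ⟨x, hx, hxa⟩ := hT a (Finset.mem_insert_of_mem ha)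
    exact ⟨x, ⟨hx, hxa ▸ Units.val_lt_val.2 (hm a ha)⟩, hxa⟩

theorem finrank_le_card_of_forall_valuation_mem (hk : ∀ c : k, v (algebraMap k K c) ≤ 1)
    (hleaf : ∀ x y, y ≠ 0 → v x = v y → ∃ c : k, v (x - c • y) < v y)
    (T : Finset Γˣ) (E : Submodule k K) [FiniteDimensional k E]
    (hT : ∀ x ∈ E, x ≠ 0 → ∃ m ∈ T, v x = m) : Module.finrank k E ≤ T.card := by
  induction T using Finset.induction_on_max generalizing E with
  | empty =>
    have : E = ⊥ := (Submodule.eq_bot_iff _).2 fun x hx ↦ by simpa using hT x hx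
    simp [this]
  | insert m T hm ih =>
    rw [Finset.card_insert_of_notMem fun h ↦ (hm m h).false]
    have hle : E.valuationLT hk m ≤ E := fun x hx ↦ hx.1
    have := Submodule.finiteDimensional_of_le hle
    have hlt : Module.finrank k (E.valuationLT hk m) ≤ T.card := ih _ fun x hx hx0 ↦ by
      obtain ⟨a, ha, hxa⟩ := hT x hx.1 hx0
      refine ⟨a, (Finset.mem_insert.1 ha).resolve_left ?_, hxa⟩
      rintro rfl
      exact hx.2.ne hxa
    by_cases hf : ∃ f ∈ E, v f = m
    · obtain ⟨f, hf, hfm⟩ := hf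
      have hf0 : f ≠ 0 := by
        rintro rfl
        simp [eq_comm] at hfm
      have hsup : E ≤ E.valuationLT hk m ⊔ k ∙ f := fun x hx ↦ by
        by_cases hxm : v x < m
        · exact Submodule.mem_sup_left ⟨hx, hxm⟩
        have hx0 : x ≠ 0 := by
          rintro rfl
          simp at hxm
        obtain ⟨a, ha, hxa⟩ := hT x hx hx0
        rcases Finset.mem_insert.1 ha with rfl | ha
        · obtain ⟨c, hc⟩ := hleaf x f hf0 (hxa.trans hfm.symm)
          rw [← sub_add_cancel x (c • f)]
          exact Submodule.add_mem_sup ⟨E.sub_mem hx (E.smul_mem c hf), hfm ▸ hc⟩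
            (Submodule.smul_mem _ _ (Submodule.mem_span_singleton_self f))
        · exact (hxm (hxa ▸ Units.val_lt_val.2 (hm a ha))).elim
      calc Module.finrank k E ≤ _ := Submodule.finrank_mono hsup
        _ ≤ _ := Submodule.finrank_add_le_finrank_add_finrank _ _
        _ ≤ T.card + 1 := Nat.add_le_add hlt (finrank_span_singleton hf0).le
    · refine (ih E fun x hx hx0 ↦ ?_).trans (Nat.le_succ _)
      obtain ⟨a, ha, hxa⟩ := hT x hx hx0
      refine ⟨a, (Finset.mem_insert.1 ha).resolve_left ?_, hxa⟩
      rintro rfl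
      exact hf ⟨x, hx, hxa⟩

/-- If the leaves of `v` are one-dimensional, a finite-dimensional space takes as many nonzero
values as its dimension. -/
theorem exists_finset_valuation_card_eq_finrank (hk : ∀ c : k, v (algebraMap k K c) ≤ 1)
    (hleaf : ∀ x y, y ≠ 0 → v x = v y → ∃ c : k, v (x - c • y) < v y)
    (E : Submodule k K) [FiniteDimensional k E] :
    ∃ T : Finset Γˣ, (∀ m ∈ T, ∃ x ∈ E, v x = m) ∧ T.card = Module.finrank k E := by
  have hfin : {m : Γˣ | ∃ x ∈ E, v x = m}.Finite := by
    by_contra h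
    obtain ⟨T, hT, hcard⟩ := Set.Infinite.exists_subset_card_eq h (Module.finrank k E + 1)
    have := card_le_finrank_of_forall_exists_valuation_eq hk T E fun m hm ↦ hT hm
    omega
  refine ⟨hfin.toFinset, fun m hm ↦ by simpa using hm, le_antisymm
    (card_le_finrank_of_forall_exists_valuation_eq hk _ E fun m hm ↦ by simpa using hm)
    (finrank_le_card_of_forall_valuation_mem hk hleaf _ E fun x hx hx0 ↦
      ⟨Units.mk0 (v x) (v.ne_zero_iff.2 hx0), by simpa using ⟨x, hx, rfl⟩, rfl⟩)⟩

end Leaves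

open Pointwise in
/-- **Hopf's theorem** for the multiplication of an extension of an algebraically closed field. -/
theorem Submodule.finrank_add_finrank_sub_one_le_finrank_mul [Algebra k K] (A B : Submodule k K)
    [FiniteDimensional k A] [FiniteDimensional k B] (hA : A ≠ ⊥) (hB : B ≠ ⊥) :
    Module.finrank k A + Module.finrank k B - 1 ≤ Module.finrank k (A * B : Submodule k K) := by
  classical
  obtain ⟨V, hk, hleaf⟩ := exists_valuation_sub_smul_lt k K
  obtain ⟨S, hS, hSA⟩ := exists_finset_valuation_card_eq_finrank hk hleaf A
  obtain ⟨T, hT, hTB⟩ := exists_finset_valuation_card_eq_finrank hk hleaf B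
  have hS0 : S.Nonempty := Finset.card_pos.1 (hSA ▸ (Submodule.one_le_finrank_iff.2 hA))
  have hT0 : T.Nonempty := Finset.card_pos.1 (hTB ▸ (Submodule.one_le_finrank_iff.2 hB))
  have : FiniteDimensional k (A * B : Submodule k K) := .of_fg <|
    Submodule.FG.mul (Module.Finite.iff_fg.1 ‹_›) (Module.Finite.iff_fg.1 ‹_›)
  rw [← hSA, ← hTB]
  refine (cauchy_davenport_mul_of_linearOrder_isCancelMul hS0 hT0).trans
    (card_le_finrank_of_forall_exists_valuation_eq hk _ _ fun m hm ↦ ?_)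
  obtain ⟨a, ha, b, hb, rfl⟩ := Finset.mem_mul.1 hm
  obtain ⟨x, hx, hxa⟩ := hS a ha
  obtain ⟨y, hy, hyb⟩ := hT b hb
  exact ⟨x * y, Submodule.mul_mem_mul hx hy, by simp [hxa, hyb]⟩

end Field

/-- **Hopf's theorem applied to the multiplication of an integral domain.**
If `R` is a commutative ℂ-algebra which is an integral domain and `A`, `B` are
nonzero finite-dimensional ℂ-linear subspaces of `R`, then the ℂ-span of the set
of products `{a * b : a ∈ A, b ∈ B}` has dimension at least `dim A + dim B - 1`. -/
theorem hopf_mul_span_finrank_ge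
    {R : Type*} [CommRing R] [IsDomain R] [Algebra ℂ R]
    (A B : Submodule ℂ R)
    [FiniteDimensional ℂ A] [FiniteDimensional ℂ B]
    (hA : A ≠ ⊥) (hB : B ≠ ⊥) :
    Module.finrank ℂ A + Module.finrank ℂ B - 1 ≤
      Module.finrank ℂ
        (Submodule.span ℂ {x : R | ∃ a ∈ A, ∃ b ∈ B, x = a * b}) := by
  have hspan : Submodule.span ℂ {x : R | ∃ a ∈ A, ∃ b ∈ B, x = a * b} = A * B := by
    rw [Submodule.mul_eq_span_mul_set]
    congr 1
    ext x
    simp [Set.mem_mul, eq_comm]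
  let ι : R →ₐ[ℂ] FractionRing R := IsScalarTower.toAlgHom ℂ R (FractionRing R)
  have hι : Function.Injective ι.toLinearMap := IsFractionRing.injective R (FractionRing R)
  have h := Submodule.finrank_add_finrank_sub_one_le_finrank_mul
    (A.map ι.toLinearMap) (B.map ι.toLinearMap)
    (fun h ↦ hA (Submodule.map_injective_of_injective hι (h.trans (Submodule.map_bot _).symm)))
    (fun h ↦ hB (Submodule.map_injective_of_injective hι (h.trans (Submodule.map_bot _).symm)))
  rwa [← Submodule.map_mul,
    ← (Submodule.equivMapOfInjective _ hι A).finrank_eq,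
    ← (Submodule.equivMapOfInjective _ hι B).finrank_eq,
    ← (Submodule.equivMapOfInjective _ hι (A * B)).finrank_eq,
    ← hspan] at h
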